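/- Let μ be a Gaussian measure on ℝ^d with mean m and covariance K, let G : ℝ^d → ℝⁿ be linear with K_{GG} := G K Gᵀ invertible, and let ν := μ ∘ G^{-1}. Define for y ∈ ℝⁿ the Gaussian measure μ_y on ℝ^d with mean m̃(y) = m + K Gᵀ K_{GG}^{-1}(y − Gm) and covariance K̃ = K − K Gᵀ K_{GG}^{-1} G K. Then the family (μ_y)_{y ∈ ℝⁿ} is a disintegration of μ with respect to G: (i) y ↦ μ_y(A) is measurable for each Borel set A; (ii) μ_y(G^{-1}({y})) = 1 for ν-almost every y; (iii) μ(A) = ∫_{ℝⁿ} μ_y(A) dν(y) for every Borel set A ⊆ ℝ^d. -/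

import Mathlib

open MeasureTheory ProbabilityTheory Matrix

/-- `μ` has the characteristic function of the Gaussian law with mean `m` and covariance `K`. -/
def HasGaussianCharFun {d : ℕ} (μ : Measure (Fin d → ℝ)) (m : Fin d → ℝ)
    (K : Matrix (Fin d) (Fin d) ℝ) : Prop :=
  ∀ u : Fin d → ℝ,
    ∫ x, Complex.exp (Complex.I * ((x ⬝ᵥ u : ℝ) : ℂ)) ∂μ
      = Complex.exp (Complex.I * ((m ⬝ᵥ u : ℝ) : ℂ)
          - (1 / 2 : ℂ) * (((K *ᵥ u) ⬝ᵥ u : ℝ) : ℂ))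

theorem continuous_cexp_I_mul_dotProduct {d : ℕ} (u : Fin d → ℝ) :
    Continuous fun x : Fin d → ℝ => Complex.exp (Complex.I * ((x ⬝ᵥ u : ℝ) : ℂ)) := by
  have h : Continuous fun x : Fin d → ℝ => x ⬝ᵥ u := continuous_id.dotProduct continuous_const
  fun_prop

theorem continuous_mulVec_const {d n : ℕ} (A : Matrix (Fin n) (Fin d) ℝ) :
    Continuous fun x : Fin d → ℝ => A *ᵥ x :=
  continuous_const.matrix_mulVec continuous_id

/-- The functions `x ↦ exp (i x ⬝ᵥ u)` separate finite measures on `ℝ^d`. -/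
theorem ext_of_integral_cexp_dotProduct {d : ℕ} {μ ν : Measure (Fin d → ℝ)}
    [IsFiniteMeasure μ] [IsFiniteMeasure ν]
    (h : ∀ u : Fin d → ℝ, ∫ x, Complex.exp (Complex.I * ((x ⬝ᵥ u : ℝ) : ℂ)) ∂μ
      = ∫ x, Complex.exp (Complex.I * ((x ⬝ᵥ u : ℝ) : ℂ)) ∂ν) : μ = ν := by
  refine Measure.ext_of_charFunDual (funext fun L => ?_)
  have hL : ∀ x : Fin d → ℝ, L x = x ⬝ᵥ fun i => L (Pi.single i 1) := fun x => by
    conv_lhs => rw [pi_eq_sum_univ' x]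
    simp [dotProduct, map_sum, Pi.single]
  simp only [charFunDual_apply, mul_comm _ Complex.I]
  convert h fun i => L (Pi.single i 1) using 5 <;> rw [hL]

theorem HasGaussianCharFun.ext {d : ℕ} {μ ν : Measure (Fin d → ℝ)}
    [IsFiniteMeasure μ] [IsFiniteMeasure ν] {m : Fin d → ℝ} {K : Matrix (Fin d) (Fin d) ℝ}
    (hμ : HasGaussianCharFun μ m K) (hν : HasGaussianCharFun ν m K) : μ = ν :=
  ext_of_integral_cexp_dotProduct fun u => (hμ u).trans (hν u).symm

theorem HasGaussianCharFun.map_mulVec {d n : ℕ} {μ : Measure (Fin d → ℝ)} {m : Fin d → ℝ}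
    {K : Matrix (Fin d) (Fin d) ℝ} (hμ : HasGaussianCharFun μ m K)
    (A : Matrix (Fin n) (Fin d) ℝ) :
    HasGaussianCharFun (μ.map (A *ᵥ ·)) (A *ᵥ m) (A * K * Aᵀ) := by
  have key : ∀ (x : Fin d → ℝ) (u : Fin n → ℝ), (A *ᵥ x) ⬝ᵥ u = x ⬝ᵥ (Aᵀ *ᵥ u) := fun x u => by
    rw [dotProduct_comm, dotProduct_mulVec, dotProduct_comm, mulVec_transpose]
  intro u
  rw [integral_map (continuous_mulVec_const A).aemeasurable
    (continuous_cexp_I_mul_dotProduct u).aestronglyMeasurable]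
  simp only [key, ← mulVec_mulVec]
  exact hμ (Aᵀ *ᵥ u)

theorem HasGaussianCharFun.map_add_const {d : ℕ} {μ : Measure (Fin d → ℝ)} {m : Fin d → ℝ}
    {K : Matrix (Fin d) (Fin d) ℝ} (hμ : HasGaussianCharFun μ m K) (c : Fin d → ℝ) :
    HasGaussianCharFun (μ.map (· + c)) (m + c) K := by
  intro u
  rw [integral_map (by fun_prop) (continuous_cexp_I_mul_dotProduct u).aestronglyMeasurable]
  simp only [add_dotProduct, Complex.ofReal_add, mul_add, Complex.exp_add]
  rw [integral_mul_const, hμ u, ← Complex.exp_add]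
  ring_nf

theorem HasGaussianCharFun.conv {d : ℕ} {μ ν : Measure (Fin d → ℝ)} [SFinite μ] [SFinite ν]
    {m m' : Fin d → ℝ} {K K' : Matrix (Fin d) (Fin d) ℝ}
    (hμ : HasGaussianCharFun μ m K) (hν : HasGaussianCharFun ν m' K') :
    HasGaussianCharFun (μ ∗ ν) (m + m') (K + K') := by
  intro u
  rw [Measure.conv, integral_map (by fun_prop)
    (continuous_cexp_I_mul_dotProduct u).aestronglyMeasurable]
  simp only [add_dotProduct, Complex.ofReal_add, mul_add, Complex.exp_add, add_mulVec]
  rw [integral_prod_mul (fun x : Fin d → ℝ => Complex.exp (Complex.I * ((x ⬝ᵥ u : ℝ) : ℂ)))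
    (fun x : Fin d → ℝ => Complex.exp (Complex.I * ((x ⬝ᵥ u : ℝ) : ℂ))), hμ u, hν u,
    ← Complex.exp_add]
  ring_nf

section GainMatrix

variable {d n : ℕ} {K : Matrix (Fin d) (Fin d) ℝ} {G : Matrix (Fin n) (Fin d) ℝ}

/-- The gain matrix `K Gᵀ (G K Gᵀ)⁻¹` is a right inverse of `G`. -/
theorem mul_gain (hinv : IsUnit (G * K * Gᵀ).det) :
    G * (K * Gᵀ * (G * K * Gᵀ)⁻¹) = 1 := by
  rw [← mul_nonsing_inv _ hinv]
  simp only [Matrix.mul_assoc]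

/-- The covariance of the residual `x - C G x`, where `C` is the gain matrix. -/
theorem residual_covariance (hinv : IsUnit (G * K * Gᵀ).det) :
    (1 - K * Gᵀ * (G * K * Gᵀ)⁻¹ * G) * K * (1 - K * Gᵀ * (G * K * Gᵀ)⁻¹ * G)ᵀ
      = K - K * Gᵀ * (G * K * Gᵀ)⁻¹ * G * K := by
  have h : (1 - K * Gᵀ * (G * K * Gᵀ)⁻¹ * G) * K * Gᵀ = 0 := by
    have h' : K * Gᵀ * (G * K * Gᵀ)⁻¹ * (G * K * Gᵀ) = K * Gᵀ :=
      nonsing_inv_mul_cancel_right _ _ hinv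
    rw [Matrix.sub_mul, Matrix.sub_mul, Matrix.one_mul, sub_eq_zero]
    simpa only [Matrix.mul_assoc] using h'.symm
  rw [transpose_sub, transpose_one, Matrix.mul_sub, Matrix.mul_one, transpose_mul,
    ← Matrix.mul_assoc, h, Matrix.zero_mul, sub_zero, Matrix.sub_mul, Matrix.one_mul]

/-- The covariance of the prediction `C G x`, where `C` is the gain matrix. -/
theorem prediction_covariance (hK : Kᵀ = K) (hinv : IsUnit (G * K * Gᵀ).det) :
    K * Gᵀ * (G * K * Gᵀ)⁻¹ * G * K * (K * Gᵀ * (G * K * Gᵀ)⁻¹ * G)ᵀ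
      = K * Gᵀ * (G * K * Gᵀ)⁻¹ * G * K := by
  have hS : (G * K * Gᵀ)ᵀ = G * K * Gᵀ := by
    simp only [transpose_mul, transpose_transpose, hK, Matrix.mul_assoc]
  have h' : K * Gᵀ * (G * K * Gᵀ)⁻¹ * (G * K * Gᵀ) = K * Gᵀ :=
    nonsing_inv_mul_cancel_right _ _ hinv
  have ht : (K * Gᵀ * (G * K * Gᵀ)⁻¹ * G)ᵀ = Gᵀ * ((G * K * Gᵀ)⁻¹ * (G * K)) := by
    rw [transpose_mul, transpose_mul, transpose_nonsing_inv, hS, transpose_mul,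
      transpose_transpose, hK]
  rw [ht]
  calc _ = K * Gᵀ * (G * K * Gᵀ)⁻¹ * (G * K * Gᵀ) * ((G * K * Gᵀ)⁻¹ * (G * K)) := by
        simp only [Matrix.mul_assoc]
    _ = _ := by rw [h']; simp only [Matrix.mul_assoc]

end GainMatrix

/-- The family of conditional Gaussian measures `μ_y` with mean
`m̃(y) = m + K Gᵀ K_{GG}⁻¹ (y − G m)` and covariance `K̃ = K − K Gᵀ K_{GG}⁻¹ G K` is a
disintegration of the Gaussian measure `μ = N(m, K)` on `ℝ^d` with respect to the linear
map `G`: (i) `y ↦ μ_y A` is measurable, (ii) `μ_y` is concentrated on the fiber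
`G⁻¹({y})` for `ν`-a.e. `y` (with `ν = μ ∘ G⁻¹`), and (iii) `μ = ∫ μ_y dν(y)`.
Gaussian measures are characterized here via their characteristic functions. -/
theorem stmt_17 {d n : ℕ} (K : Matrix (Fin d) (Fin d) ℝ) (hK : K.PosSemidef)
    (m : Fin d → ℝ) (G : Matrix (Fin n) (Fin d) ℝ)
    (hinv : IsUnit (G * K * Gᵀ).det)
    (μ : Measure (Fin d → ℝ)) [IsProbabilityMeasure μ]
    -- μ is Gaussian with mean m and covariance K
    (hμ : ∀ u : Fin d → ℝ,
      ∫ x, Complex.exp (Complex.I * ((x ⬝ᵥ u : ℝ) : ℂ)) ∂μ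
        = Complex.exp (Complex.I * ((m ⬝ᵥ u : ℝ) : ℂ)
            - (1 / 2 : ℂ) * (((K *ᵥ u) ⬝ᵥ u : ℝ) : ℂ)))
    -- the family μ_y: Gaussian with mean m̃(y) and covariance K̃
    (κ : (Fin n → ℝ) → Measure (Fin d → ℝ)) (hκprob : ∀ y, IsProbabilityMeasure (κ y))
    (hκ : ∀ (y : Fin n → ℝ) (u : Fin d → ℝ),
      ∫ x, Complex.exp (Complex.I * ((x ⬝ᵥ u : ℝ) : ℂ)) ∂(κ y)
        = Complex.exp (Complex.I *
              (((m + (K * Gᵀ * (G * K * Gᵀ)⁻¹) *ᵥ (y - G *ᵥ m)) ⬝ᵥ u : ℝ) : ℂ)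
            - (1 / 2 : ℂ) *
              ((((K - K * Gᵀ * (G * K * Gᵀ)⁻¹ * G * K) *ᵥ u) ⬝ᵥ u : ℝ) : ℂ))) :
    (∀ A : Set (Fin d → ℝ), MeasurableSet A → Measurable fun y => κ y A) ∧
    (∀ᵐ y ∂(μ.map (G *ᵥ ·)), κ y {x | G *ᵥ x = y} = 1) ∧
    (∀ A : Set (Fin d → ℝ), MeasurableSet A →
      μ A = ∫⁻ y, κ y A ∂(μ.map (G *ᵥ ·))) := by
  have hKt : Kᵀ = K := by simpa [conjTranspose_eq_transpose_of_trivial] using hK.isHermitian.eq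
  have hGC := mul_gain hinv
  have hres := residual_covariance hinv
  have hpred := prediction_covariance hKt hinv
  set C := K * Gᵀ * (G * K * Gᵀ)⁻¹
  have hμ' : HasGaussianCharFun μ m K := hμ
  have hG := (continuous_mulVec_const G).measurable
  have hCm := (continuous_mulVec_const C).measurable
  have hP := (continuous_mulVec_const (1 - C * G)).measurable
  set ρ := μ.map ((1 - C * G) *ᵥ ·) with hρ
  have : IsProbabilityMeasure ρ := Measure.isProbabilityMeasure_map hP.aemeasurable
  have : IsProbabilityMeasure (μ.map (G *ᵥ ·)) :=
    Measure.isProbabilityMeasure_map hG.aemeasurable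
  have hκρ : ∀ y, κ y = ρ.map (· + C *ᵥ y) := fun y => by
    have := hκprob y
    have : IsProbabilityMeasure (ρ.map (· + C *ᵥ y)) :=
      Measure.isProbabilityMeasure_map (by fun_prop)
    refine HasGaussianCharFun.ext (hκ y) ?_
    convert (hμ'.map_mulVec (1 - C * G)).map_add_const (C *ᵥ y) using 1
    · rw [mulVec_sub, sub_mulVec, one_mulVec, mulVec_mulVec]
      abel
    · exact hres.symm
  have hκA : ∀ A : Set (Fin d → ℝ), MeasurableSet A →
      ∀ y, κ y A = ρ ((fun z => (z, C *ᵥ y)) ⁻¹' ((fun p => p.1 + p.2) ⁻¹' A)) :=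
    fun A hA y => by
      rw [hκρ, Measure.map_apply (by fun_prop) hA]
      rfl
  have hadd : ∀ A : Set (Fin d → ℝ), MeasurableSet A →
      MeasurableSet ((fun p : (Fin d → ℝ) × (Fin d → ℝ) => p.1 + p.2) ⁻¹' A) :=
    fun A hA => (measurable_fst.add measurable_snd) hA
  refine ⟨fun A hA => ?_, .of_forall fun y => ?_, fun A hA => ?_⟩
  · simp only [hκA A hA]
    exact (measurable_measure_prodMk_right (hadd A hA)).comp hCm
  · have hfib : MeasurableSet {x : Fin d → ℝ | G *ᵥ x = y} := hG (measurableSet_singleton y)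
    have huniv : ((1 - C * G) *ᵥ ·) ⁻¹' ((· + C *ᵥ y) ⁻¹' {x : Fin d → ℝ | G *ᵥ x = y})
        = Set.univ := by
      refine Set.eq_univ_of_forall fun x => ?_
      change G *ᵥ ((1 - C * G) *ᵥ x + C *ᵥ y) = y
      rw [mulVec_add, mulVec_mulVec, mulVec_mulVec, hGC, Matrix.mul_sub, ← Matrix.mul_assoc, hGC,
        Matrix.mul_one, Matrix.one_mul, sub_self, zero_mulVec, zero_add, one_mulVec]
    rw [hκρ, Measure.map_apply (by fun_prop) hfib, hρ,
      Measure.map_apply hP ((measurable_add_const _) hfib), huniv, measure_univ]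
  · have hconv : μ = ρ ∗ (μ.map (G *ᵥ ·)).map (C *ᵥ ·) := by
      have : IsProbabilityMeasure ((μ.map (G *ᵥ ·)).map (C *ᵥ ·)) :=
        Measure.isProbabilityMeasure_map hCm.aemeasurable
      refine hμ'.ext ?_
      have hmap : (μ.map (G *ᵥ ·)).map (C *ᵥ ·) = μ.map ((C * G) *ᵥ ·) := by
        rw [Measure.map_map hCm hG]
        simp only [Function.comp_def, mulVec_mulVec]
      have : IsProbabilityMeasure (μ.map ((C * G) *ᵥ ·)) := hmap ▸ this
      rw [hmap]
      convert (hμ'.map_mulVec (1 - C * G)).conv (hμ'.map_mulVec (C * G)) using 1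
      · rw [sub_mulVec, one_mulVec, sub_add_cancel]
      · rw [hres, hpred, sub_add_cancel]
    have hmeas := measurable_measure_prodMk_right (μ := ρ) (hadd A hA)
    conv_lhs => rw [hconv]
    rw [Measure.conv, Measure.map_apply (by fun_prop) hA, Measure.prod_apply_symm (hadd A hA),
      lintegral_map hmeas hCm]
    simp only [hκA A hA]
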